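/- arXiv:0901.0382 — 2 statements merged into one kernel-verified Lean document; each statement's English description precedes it below -/
import Mathlib

section
/- Let (Ω, F, P, θ) be an ergodic measurable metric dynamical system and X : Ω → (0,∞) a random variable. Then either X is tempered (limsup_{t→±∞} (log⁺ X(θ_t ω))/t = 0 on an invariant set of full measure), or there exists a θ-invariant set Ω̃ of full measure such that limsup_{t→±∞} (log⁺ X(θ_t ω))/t = +∞ for all ω ∈ Ω̃. -/
open MeasureTheory Filter

lemma aux_capacity {Y : Type*} [TopologicalSpace Y] [PolishSpace Y] [MeasurableSpace Y]
    [BorelSpace Y] (ν : Measure Y) [IsFiniteMeasure ν] (g : (ℕ → ℕ) → Y) (hg : Continuous g)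
    (r : ENNReal) (hr : r < ν (Set.range g)) :
    ∃ K : Set (ℕ → ℕ), IsCompact K ∧ r ≤ ν (g '' K) := by
  have step : ∀ C : {C : Set (ℕ → ℕ) // r < ν (g '' C)}, ∀ i : ℕ,
      ∃ n : ℕ, r < ν (g '' (C.1 ∩ {x | x i ≤ n})) := by
    intro C i
    have h1 : g '' C.1 = ⋃ n : ℕ, g '' (C.1 ∩ {x | x i ≤ n}) := by
      rw [← Set.image_iUnion, ← Set.inter_iUnion]
      congr 1
      ext x
      simp only [Set.mem_inter_iff, Set.mem_iUnion, Set.mem_ofPred_eq]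
      exact ⟨fun h => ⟨h, x i, le_rfl⟩, fun h => h.1⟩
    have hmono : Monotone fun n : ℕ => g '' (C.1 ∩ {x | x i ≤ n}) := by
      intro a b hab
      apply Set.image_mono
      rintro x ⟨h, h'⟩
      exact ⟨h, le_trans h' hab⟩
    have h2 := C.2
    rw [h1, hmono.measure_iUnion] at h2
    exact lt_iSup_iff.1 h2
  choose N hN using step
  let D : ℕ → {C : Set (ℕ → ℕ) // r < ν (g '' C)} := fun k =>
    Nat.rec ⟨Set.univ, by simpa using hr⟩ (fun i C => ⟨C.1 ∩ {x | x i ≤ N C i}, hN C i⟩) k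
  let n : ℕ → ℕ := fun k => N (D k) k
  have hD : ∀ k, (D k).1 = {x | ∀ i < k, x i ≤ n i} := by
    intro k
    induction k with
    | zero => simp [D]
    | succ k ih =>
      have : (D (k+1)).1 = (D k).1 ∩ {x | x k ≤ n k} := rfl
      rw [this, ih]
      ext x
      simp only [Set.mem_inter_iff, Set.mem_ofPred_eq, Nat.lt_succ_iff_lt_or_eq]
      constructor
      · rintro ⟨h, h'⟩ i (hi | rfl)
        · exact h i hi
        · exact h'
      · intro h
        exact ⟨fun i hi => h i (Or.inl hi), h k (Or.inr rfl)⟩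
  let K : Set (ℕ → ℕ) := Set.univ.pi fun i => Set.Iic (n i)
  have hK : IsCompact K := isCompact_univ_pi fun i => (Set.finite_Iic (n i)).isCompact
  refine ⟨K, hK, ?_⟩
  by_contra! hlt
  obtain ⟨U, hKU, hU, hUr⟩ := Set.exists_isOpen_lt_of_lt _ _ hlt
  have hex : ∀ k, ∃ x ∈ (D k).1, g x ∉ U := by
    intro k
    by_contra! h
    have : g '' (D k).1 ⊆ U := by rintro _ ⟨x, hx, rfl⟩; exact h x hx
    exact absurd ((D k).2.trans_le (measure_mono this)) (not_lt.2 hUr.le)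
  choose x hx hxU using hex
  let y : ℕ → ℕ → ℕ := fun k i => min (x k i) (n i)
  have hy : ∀ k, y k ∈ K := fun k i _ => Set.mem_Iic.2 (min_le_right (x k i) (n i))
  obtain ⟨z, hz, ψ, hψ, hlim⟩ := hK.tendsto_subseq hy
  have hlim2 : Tendsto (x ∘ ψ) atTop (nhds z) := by
    rw [tendsto_pi_nhds] at hlim ⊢
    intro i
    refine (hlim i).congr' ?_
    filter_upwards [eventually_gt_atTop i] with k hk
    have h1 : i < ψ k := hk.trans_le (hψ.id_le k)
    have h2 := hx (ψ k)
    rw [hD] at h2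
    simp only [Function.comp, y]
    exact min_eq_left (h2 i h1)
  have hmem : g z ∈ U := hKU ⟨z, hz, rfl⟩
  have := ((hg.tendsto z).comp hlim2).eventually (hU.mem_nhds hmem)
  obtain ⟨k, hk⟩ := this.exists
  exact hxU _ hk

lemma aux_analytic {Y : Type*} [TopologicalSpace Y] [PolishSpace Y] [MeasurableSpace Y]
    [BorelSpace Y] (ν : Measure Y) [IsFiniteMeasure ν] (A : Set Y) (hA : AnalyticSet A) :
    NullMeasurableSet A ν := by
  rw [AnalyticSet] at hA
  rcases hA with rfl | ⟨g, hg, rfl⟩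
  · exact nullMeasurableSet_empty
  by_cases h0 : ν (Set.range g) = 0
  · exact NullMeasurableSet.of_null h0
  obtain ⟨u, -, hu, hlim⟩ := exists_seq_strictMono_tendsto' (pos_iff_ne_zero.2 h0)
  choose K hK hKr using fun k => aux_capacity ν g hg (u k) (hu k).2
  let B : Set Y := ⋃ k, g '' K k
  have hB : MeasurableSet B :=
    MeasurableSet.iUnion fun k => ((hK k).image hg).isClosed.measurableSet
  have hBA : B ⊆ Set.range g := Set.iUnion_subset fun k => Set.image_subset_range _ _
  have hle : ν (Set.range g) ≤ ν B :=
    le_of_tendsto' hlim fun k => (hKr k).trans (measure_mono (Set.subset_iUnion (fun k => g '' K k) k))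
  have : B =ᵐ[ν] Set.range g :=
    ae_eq_of_subset_of_measure_ge hBA hle hB.nullMeasurableSet (measure_ne_top _ _)
  exact hB.nullMeasurableSet.congr this

lemma aux_factor {Ω : Type*} [MeasurableSpace Ω] (s : Set (ℝ × Ω)) (hs : MeasurableSet s) :
    ∃ (Y : Type) (_ : MeasurableSpace Y) (_ : StandardBorelSpace Y) (φ : Ω → Y)
      (B : Set (ℝ × Y)), Measurable φ ∧ MeasurableSet B ∧ s = (Prod.map id φ) ⁻¹' B := by
  induction s, hs using MeasurableSpace.induction_on_inter generateFrom_prod.symm isPiSystem_prod with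
  | empty => exact ⟨Bool, inferInstance, inferInstance, fun _ => true, ∅, measurable_const, .empty, by simp⟩
  | basic t ht =>
    obtain ⟨a, ha, b, hb, rfl⟩ := ht
    classical
    refine ⟨Bool, inferInstance, inferInstance, fun ω => decide (ω ∈ b), a ×ˢ {true},
      ?_, MeasurableSet.prod ha (measurableSet_singleton _), ?_⟩
    · exact measurable_to_bool (by
        have : (fun ω => decide (ω ∈ b)) ⁻¹' {true} = b := by ext; simp
        rw [this]; exact hb)
    · ext ⟨x, y⟩; simp
  | compl t ht ih =>
    obtain ⟨Y, _, _, φ, B, hφ, hB, rfl⟩ := ih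
    exact ⟨Y, inferInstance, inferInstance, φ, Bᶜ, hφ, hB.compl, rfl⟩
  | iUnion t hd ht ih =>
    choose Y m1 m2 φ B hφ hB hE using ih
    refine ⟨∀ n, Y n, inferInstance, inferInstance, fun ω n => φ n ω,
      ⋃ n, (Prod.map id (fun y : ∀ n, Y n => y n)) ⁻¹' B n, measurable_pi_lambda _ hφ,
      MeasurableSet.iUnion fun n => (measurable_id.prodMap (measurable_pi_apply n)) (hB n), ?_⟩
    rw [Set.preimage_iUnion]
    refine Set.iUnion_congr fun n => ?_
    rw [hE n]; rfl

lemma aux_proj {Ω : Type*} [MeasurableSpace Ω] (P : Measure Ω) [IsFiniteMeasure P]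
    (s : Set (ℝ × Ω)) (hs : MeasurableSet s) : NullMeasurableSet {ω | ∃ t, (t, ω) ∈ s} P := by
  obtain ⟨Y, _, _, φ, B, hφ, hB, rfl⟩ := aux_factor s hs
  let _ := upgradeStandardBorel Y
  have h1 : AnalyticSet (Prod.snd '' B) := hB.analyticSet.image_of_continuous continuous_snd
  have h2 : NullMeasurableSet (Prod.snd '' B) (P.map φ) := aux_analytic _ _ h1
  have h3 := h2.preimage (hφ.measurePreserving P).quasiMeasurePreserving
  convert h3 using 1
  ext ω
  simp

/-- Kac-type gap estimate. -/
lemma aux_gap {Ω : Type*} [MeasurableSpace Ω] (P : Measure Ω) [IsProbabilityMeasure P]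
    (T : Ω ≃ᵐ Ω) (hT : MeasurePreserving T P P) (A : Set Ω) (hA : MeasurableSet A) (ε : ℝ)
    (hε : 0 < ε) :
    ∀ᵐ ω ∂P, ω ∈ A → ∀ᶠ n : ℕ in atTop, ∃ k j : ℕ, k ≤ n ∧ n < j ∧ (j : ℝ) - k ≤ ε * n ∧
      T^[k] ω ∈ A ∧ T^[j] ω ∈ A := by
  -- points of A not returning up to time k
  let E : ℕ → Set Ω := fun k => A ∩ ⋂ j ∈ Finset.Icc 1 k, (T^[j]) ⁻¹' Aᶜ
  have hTk : ∀ k, MeasurePreserving (T^[k]) P P := fun k => hT.iterate k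
  have hE : ∀ k, MeasurableSet (E k) := fun k =>
    hA.inter (Finset.measurableSet_biInter _ fun j _ => (hTk j).measurable hA.compl)
  have hinj : ∀ k, Function.Injective (T^[k]) := fun k => T.injective.iterate k
  have hsum : ∑' k, P (E k) ≤ 1 := by
    have him : ∀ k, P ((T.symm^[k]) ⁻¹' E k) = P (E k) := fun k =>
      ((hT.symm T).iterate k).measure_preimage (hE k).nullMeasurableSet
    simp_rw [← him]
    rw [← measure_iUnion]
    · exact prob_le_one
    · have key : ∀ k j, k < j →
          Disjoint ((T.symm^[k]) ⁻¹' E k) ((T.symm^[j]) ⁻¹' E j) := by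
        intro k j hkj
        rw [Set.disjoint_left]
        rintro x hx hx'
        have h1 : T.symm^[k] x ∈ A := hx.1
        have h2 := hx'.2
        simp only [Set.mem_iInter] at h2
        have h3 := h2 (j - k) (by simp; omega)
        apply h3
        have : j = (j - k) + k := by omega
        have h4 : T.symm^[j] x = T.symm^[j-k] (T.symm^[k] x) := by
          rw [← Function.iterate_add_apply, ← this]
        have hl : Function.LeftInverse (T^[j-k]) (T.symm^[j-k]) :=
          Function.LeftInverse.iterate (fun y => T.apply_symm_apply y) _
        rw [h4, hl]
        exact h1
      intro k j hkj
      rcases lt_or_gt_of_ne hkj with h | h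
      · exact key k j h
      · exact (key j k h).symm
    · exact fun k => ((hT.symm T).iterate k).measurable (hE k)
  -- Borel Cantelli along E (floor (ε k))
  have hBC : ∑' k : ℕ, P ((T^[k]) ⁻¹' (E ⌊ε * k⌋₊)) ≠ ⊤ := by
    have h0 : ∀ k : ℕ, P ((T^[k]) ⁻¹' (E ⌊ε * k⌋₊)) = P (E ⌊ε * k⌋₊) := fun k =>
      (hTk k).measure_preimage (hE _).nullMeasurableSet
    simp_rw [h0]
    -- each value of the floor is attained a bounded number of times
    obtain ⟨m, hm⟩ := exists_nat_gt ε⁻¹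
    have hm0 : 0 < (m : ℝ) := lt_trans (inv_pos.2 hε) hm
    have hm0' : 0 < m := by exact_mod_cast hm0
    have : NeZero m := ⟨hm0'.ne'⟩
    have hanti : ∀ a b, a ≤ b → E b ⊆ E a := by
      intro a b hab x hx
      refine ⟨hx.1, ?_⟩
      have h2 := hx.2
      simp only [Set.mem_iInter, Finset.mem_Icc] at h2 ⊢
      exact fun j hj => h2 j ⟨hj.1, hj.2.trans hab⟩
    have hle : ∀ k : ℕ, P (E ⌊ε * k⌋₊) ≤ P (E (k / m)) := by
      intro k
      apply measure_mono
      apply hanti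
      apply Nat.le_floor
      have h1 : ((k / m : ℕ) : ℝ) ≤ (k : ℝ) / m := Nat.cast_div_le
      refine h1.trans ?_
      rw [div_le_iff₀ hm0]
      have h2 : 1 ≤ ε * m := by
        rw [inv_lt_iff_one_lt_mul₀ hε] at hm
        linarith
      have h3 : (0 : ℝ) ≤ k := by positivity
      nlinarith
    have hs2 : ∑' k : ℕ, P (E (k / m)) = ∑' p : ℕ × Fin m, P (E p.1) := by
      rw [← (Nat.divModEquiv m).tsum_eq]
      rfl
    refine ne_top_of_le_ne_top ?_ (ENNReal.tsum_le_tsum hle)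
    rw [hs2, ENNReal.tsum_prod (f := fun a _ => P (E a))]
    simp only [tsum_fintype, Finset.sum_const, nsmul_eq_mul]
    rw [ENNReal.tsum_mul_left]
    refine ENNReal.mul_ne_top (by simp) (ne_top_of_le_ne_top ENNReal.one_ne_top hsum)
  have h1 := ae_eventually_notMem hBC
  have h2 := hT.conservative.ae_mem_imp_frequently_image_mem hA.nullMeasurableSet
  filter_upwards [h1, h2] with ω hω1 hω2 hωA
  have hfr := hω2 hωA
  obtain ⟨K, hK⟩ := eventually_atTop.1 hω1
  obtain ⟨k0, hk0, hk0A⟩ := frequently_atTop.1 hfr K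
  filter_upwards [eventually_ge_atTop k0] with n hn
  classical
  let k := Nat.findGreatest (fun i => T^[i] ω ∈ A) n
  have hkA : T^[k] ω ∈ A := Nat.findGreatest_spec (P := fun i => T^[i] ω ∈ A) hn hk0A
  have hkn : k ≤ n := Nat.findGreatest_le n
  have hk0k : k0 ≤ k := Nat.le_findGreatest hn hk0A
  have h3 := hK k (hk0.trans hk0k)
  have h4 : ∃ i, 1 ≤ i ∧ i ≤ ⌊ε * k⌋₊ ∧ T^[i] (T^[k] ω) ∈ A := by
    by_contra! h
    apply h3
    refine ⟨hkA, ?_⟩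
    simp only [Set.mem_iInter, Finset.mem_Icc]
    exact fun j hj => h j hj.1 hj.2
  obtain ⟨i, hi1, hi2, hiA⟩ := h4
  rw [← Function.iterate_add_apply] at hiA
  refine ⟨k, i + k, hkn, ?_, ?_, hkA, hiA⟩
  · by_contra! h
    have : i + k ≤ k := Nat.le_findGreatest h hiA
    omega
  · have : (i : ℝ) ≤ ε * k := (Nat.le_floor_iff (by positivity)).1 hi2
    have h5 : (k : ℝ) ≤ n := by exact_mod_cast hkn
    push_cast
    nlinarith

structure AuxFlow {Ω : Type*} [MeasurableSpace Ω] (P : Measure Ω) (θ : ℝ → Ω → Ω) : Prop where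
  meas : Measurable fun p : ℝ × Ω => θ p.1 p.2
  zero : θ 0 = id
  flow : ∀ s t : ℝ, θ t ∘ θ s = θ (t + s)
  pres : ∀ t : ℝ, MeasurePreserving (θ t) P P
  erg : ∀ S : Set Ω, MeasurableSet S → (∀ t : ℝ, θ t ⁻¹' S = S) → P S = 0 ∨ P S = 1

namespace AuxFlow

variable {Ω : Type*} [MeasurableSpace Ω] {P : Measure Ω} {θ : ℝ → Ω → Ω}

lemma add (h : AuxFlow P θ) (t s : ℝ) (ω : Ω) : θ t (θ s ω) = θ (t + s) ω :=
  congrFun (h.flow s t) ω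

lemma neg_cancel (h : AuxFlow P θ) (t : ℝ) (ω : Ω) : θ (-t) (θ t ω) = ω := by
  rw [h.add]; simp [h.zero]

lemma cancel_neg (h : AuxFlow P θ) (t : ℝ) (ω : Ω) : θ t (θ (-t) ω) = ω := by
  rw [h.add]; simp [h.zero]

lemma reverse (h : AuxFlow P θ) : AuxFlow P fun t => θ (-t) where
  meas := h.meas.comp (measurable_fst.neg.prodMk measurable_snd)
  zero := by simp [h.zero]
  flow s t := by rw [h.flow]; congr 1; ring
  pres t := h.pres _
  erg S hS hinv := h.erg S hS fun t => by simpa using hinv (-t)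

lemma meas_orbit (h : AuxFlow P θ) (ω : Ω) : Measurable fun t => θ t ω :=
  h.meas.comp (measurable_id.prodMk measurable_const)

def equiv (h : AuxFlow P θ) (t : ℝ) : Ω ≃ᵐ Ω where
  toFun := θ t
  invFun := θ (-t)
  left_inv := h.neg_cancel t
  right_inv := h.cancel_neg t
  measurable_toFun := (h.pres t).measurable
  measurable_invFun := (h.pres (-t)).measurable

lemma equiv_iterate (h : AuxFlow P θ) (t : ℝ) (k : ℕ) (ω : Ω) :
    (h.equiv t)^[k] ω = θ (k * t) ω := by
  induction k with
  | zero => simp [h.zero]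
  | succ k ih =>
    rw [Function.iterate_succ_apply', ih]
    change θ t _ = _
    rw [h.add]
    congr 1
    push_cast; ring

lemma fubini [IsProbabilityMeasure P] (h : AuxFlow P θ) {Q : Set Ω} (hQ : MeasurableSet Q)
    (hQ0 : P Q = 0) : ∀ᵐ ω ∂P, ∀ᵐ t : ℝ, θ t ω ∉ Q := by
  have h1 : ∀ᵐ t : ℝ, ∀ᵐ ω ∂P, θ t ω ∉ Q := by
    refine Eventually.of_forall fun t => ?_
    rw [ae_iff]
    have : {a | ¬ θ t a ∉ Q} = θ t ⁻¹' Q := by ext; simp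
    rw [this, (h.pres t).measure_preimage hQ.nullMeasurableSet, hQ0]
  exact (Measure.ae_ae_comm (p := fun (t : ℝ) ω => θ t ω ∉ Q) (h.meas hQ.compl)).1 h1

def W (θ : ℝ → Ω → Ω) (M : Set Ω) : Set Ω := {ω | ∀ᵐ t : ℝ, θ t ω ∈ M}

lemma W_meas (h : AuxFlow P θ) {M : Set Ω} (hM : MeasurableSet M) : MeasurableSet (W θ M) := by
  have h1 : Measurable fun ω => volume ((fun t : ℝ => (t, ω)) ⁻¹'
      ((fun p : ℝ × Ω => θ p.1 p.2) ⁻¹' Mᶜ)) :=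
    measurable_measure_prodMk_right (h.meas hM.compl)
  exact h1 (measurableSet_singleton 0)

lemma W_inv (h : AuxFlow P θ) (M : Set Ω) (s : ℝ) : θ s ⁻¹' (W θ M) = W θ M := by
  ext ω
  change (∀ᵐ t : ℝ, θ t (θ s ω) ∈ M) ↔ ∀ᵐ t : ℝ, θ t ω ∈ M
  simp_rw [h.add, ae_iff]
  have := measure_preimage_add_right (volume : Measure ℝ) s {t | θ t ω ∉ M}
  rw [← this]
  rfl

lemma zero_one [IsProbabilityMeasure P] (h : AuxFlow P θ) {N : Set Ω}
    (hN : NullMeasurableSet N P) (hinv : ∀ t : ℝ, ∀ ω ∈ N, θ t ω ∈ N) :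
    P N = 0 ∨ P Nᶜ = 0 := by
  have hinv' : ∀ t ω, θ t ω ∈ N ↔ ω ∈ N := fun t ω =>
    ⟨fun h' => by simpa [h.neg_cancel] using hinv (-t) _ h', hinv t ω⟩
  obtain ⟨M, hM, hNM⟩ := hN
  obtain ⟨Q, hQsub, hQ, hQ0⟩ := exists_measurable_superset_of_null (ae_iff.1 hNM.mem_iff)
  have hW : ∀ᵐ ω ∂P, ω ∈ W θ M ↔ ω ∈ N := by
    filter_upwards [h.fubini hQ hQ0] with ω hω
    have h1 : ∀ᵐ t : ℝ, (θ t ω ∈ M ↔ ω ∈ N) := by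
      filter_upwards [hω] with t ht
      have : θ t ω ∈ N ↔ θ t ω ∈ M := by
        by_contra hc
        exact ht (hQsub hc)
      rw [← this, hinv']
    constructor
    · intro hw
      obtain ⟨t, ht, ht'⟩ := (h1.and hw).exists
      exact ht.1 ht'
    · intro hw
      change ∀ᵐ t : ℝ, _
      filter_upwards [h1] with t ht
      exact ht.2 hw
  have hW' : W θ M =ᵐ[P] N := by
    filter_upwards [hW] with ω hω
    exact propext hω
  rcases h.erg _ (h.W_meas hM) (h.W_inv M) with h0 | h1
  · left; rw [← measure_congr hW', h0]
  · right
    rw [← measure_congr hW'.compl]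
    exact (prob_compl_eq_zero_iff (h.W_meas hM)).2 h1

lemma hull [IsProbabilityMeasure P] (h : AuxFlow P θ) {N : Set Ω}
    (hN : P N = 0) (hinv : ∀ t : ℝ, ∀ ω ∈ N, θ t ω ∈ N) :
    ∃ S : Set Ω, MeasurableSet S ∧ P Sᶜ = 0 ∧ (∀ t : ℝ, ∀ ω ∈ S, θ t ω ∈ S) ∧
      ∀ ω ∈ S, ω ∉ N := by
  obtain ⟨M, hNM, hM, hM0⟩ := exists_measurable_superset_of_null hN
  refine ⟨(W θ M)ᶜ, (h.W_meas hM).compl, ?_, ?_, ?_⟩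
  · rw [compl_compl]
    have : ∀ᵐ ω ∂P, ω ∉ W θ M := by
      filter_upwards [h.fubini hM hM0] with ω hω hw
      obtain ⟨t, ht, ht'⟩ := (hω.and hw).exists
      exact ht ht'
    simpa [ae_iff] using this
  · intro t ω hω hc
    apply hω
    rw [← h.W_inv M t]
    exact hc
  · intro ω hω hN'
    apply hω
    change ∀ᵐ t : ℝ, θ t ω ∈ M
    exact Eventually.of_forall fun t => hNM (hinv t ω hN')

def G (θ : ℝ → Ω → Ω) (f : Ω → ℝ) (c T : ℝ) : Set Ω := {ω | ∀ t ≥ T, f (θ t ω) ≤ c * t}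

lemma G_null [IsProbabilityMeasure P] (h : AuxFlow P θ) {f : Ω → ℝ} (hf : Measurable f)
    (c T : ℝ) : NullMeasurableSet (G θ f c T) P := by
  have hs : MeasurableSet {p : ℝ × Ω | T ≤ p.1 ∧ c * p.1 < f (θ p.1 p.2)} :=
    (measurableSet_le measurable_const measurable_fst).inter
      (measurableSet_lt (measurable_fst.const_mul c) (hf.comp h.meas))
  have := (aux_proj P _ hs).compl
  convert this using 1
  ext ω
  simp [G]

def Z (θ : ℝ → Ω → Ω) (f : Ω → ℝ) : Set Ω :=
  ⋂ m : ℕ, ⋃ n : ℕ, (G θ f (1 / (m + 1)) n ∩ G (fun t => θ (-t)) f (1 / (m + 1)) n)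

lemma Z_null [IsProbabilityMeasure P] (h : AuxFlow P θ) {f : Ω → ℝ} (hf : Measurable f) :
    NullMeasurableSet (Z θ f) P :=
  NullMeasurableSet.iInter fun _ => NullMeasurableSet.iUnion fun _ =>
    (h.G_null hf _ _).inter (h.reverse.G_null hf _ _)

lemma Z_reverse (f : Ω → ℝ) : Z (fun t => θ (-t)) f = Z θ f := by
  simp only [Z, neg_neg, Set.inter_comm]

lemma main [IsProbabilityMeasure P] (h : AuxFlow P θ) {f : Ω → ℝ} (hf : Measurable f) (n : ℕ)
    (hG : P (G θ f n n) ≠ 0) : P (Z θ f) ≠ 0 := by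
  obtain ⟨A, hAG, hA, hAe⟩ := (h.G_null (P := P) hf n n).exists_measurable_subset_ae_eq
  have hA0 : P A ≠ 0 := by rwa [measure_congr hAe]
  have g1 := ae_all_iff.2 fun m : ℕ =>
    aux_gap P (h.equiv 1) (h.pres 1) A hA (1 / (m + 1)) (by positivity)
  have g2 := ae_all_iff.2 fun m : ℕ =>
    aux_gap P (h.equiv (-1)) (h.pres (-1)) A hA (1 / (m + 1)) (by positivity)
  have hle : P A ≤ P (Z θ f) := by
    apply measure_mono_ae
    filter_upwards [g1, g2] with ω h1 h2 hω
    change ω ∈ Z θ f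
    simp only [Z, Set.mem_iInter, Set.mem_iUnion]
    intro m
    obtain ⟨N1, hN1⟩ := eventually_atTop.1 (h1 (4 * n * (m + 1)) hω)
    obtain ⟨N2, hN2⟩ := eventually_atTop.1 (h2 (4 * n * (m + 1)) hω)
    simp only [h.equiv_iterate] at hN1 hN2
    set ε : ℝ := 1 / (((4 * n * (m + 1) : ℕ) : ℝ) + 1) with hε
    have hε0 : 0 < ε := by positivity
    have hm0 : (0 : ℝ) < m + 1 := by positivity
    have hn0 : (0 : ℝ) ≤ n := by positivity
    have hεn : n * (2 * ε) ≤ 1 / (m + 1) / 2 := by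
      rw [hε]
      push_cast
      rw [div_div, mul_one_div, mul_div_assoc', div_le_div_iff₀ (by positivity) (by positivity)]
      nlinarith
    have hε1 : ε ≤ 1 := by
      rw [hε, div_le_one (by positivity)]
      have : (0 : ℝ) ≤ ((4 * n * (m + 1) : ℕ) : ℝ) := by positivity
      linarith
    -- final estimate
    have est : ∀ t : ℝ, 2 * (m + 1) * n * (n + 1) ≤ t →
        n * (n + 1 + 2 * ε * t) ≤ 1 / (m + 1) * t := by
      intro t ht
      have ht0 : 0 ≤ t := le_trans (by positivity) ht
      have e1 : n * (2 * ε) * t ≤ 1 / (m + 1) / 2 * t := mul_le_mul_of_nonneg_right hεn ht0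
      have e2 : (n : ℝ) * (n + 1) ≤ 1 / (m + 1) / 2 * t := by
        rw [div_div, one_div_mul_eq_div, le_div_iff₀ (by positivity)]
        linarith
      linarith
    refine ⟨N1 + N2 + 2 * (m + 1) * n * (n + 1) + n + 1, ?_, ?_⟩
    · intro t ht
      push_cast at ht
      have p0 : (0 : ℝ) ≤ N1 := by positivity
      have p1 : (0 : ℝ) ≤ N2 := by positivity
      have p2 : (0 : ℝ) ≤ 2 * (m + 1) * n * (n + 1) := by positivity
      have hfl : (⌊t - n⌋₊ : ℝ) ≤ t - n := Nat.floor_le (by linarith)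
      have hfl2 : t - n < ⌊t - n⌋₊ + 1 := Nat.lt_floor_add_one _
      obtain ⟨k, j, hk, hj, hkj, hkA, -⟩ := hN1 ⌊t - n⌋₊ (Nat.le_floor (by linarith))
      have hk' : (k : ℝ) ≤ ⌊t - n⌋₊ := by exact_mod_cast hk
      have hj' : (⌊t - n⌋₊ : ℝ) < j := by exact_mod_cast hj
      rw [mul_one] at hkA
      have h3 := hAG hkA (t - k) (by linarith)
      rw [h.add, sub_add_cancel] at h3
      refine h3.trans (le_trans ?_ (est t (by linarith)))
      apply mul_le_mul_of_nonneg_left _ hn0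
      have : ε * ⌊t - n⌋₊ ≤ ε * t := mul_le_mul_of_nonneg_left (by linarith) hε0.le
      have : 0 ≤ ε * t := mul_nonneg hε0.le (by linarith)
      linarith
    · intro t ht
      push_cast at ht
      have p0 : (0 : ℝ) ≤ N1 := by positivity
      have p1 : (0 : ℝ) ≤ N2 := by positivity
      have p2 : (0 : ℝ) ≤ 2 * (m + 1) * n * (n + 1) := by positivity
      have hc : t + n ≤ ⌈t + n⌉₊ := Nat.le_ceil _
      have hc2 : (⌈t + n⌉₊ : ℝ) < t + n + 1 := Nat.ceil_lt_add_one (by linarith)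
      obtain ⟨k, j, hk, hj, hkj, -, hjA⟩ := hN2 ⌈t + n⌉₊ (by
        have : (N2 : ℝ) ≤ ⌈t + n⌉₊ := by linarith
        exact_mod_cast this)
      have hk' : (k : ℝ) ≤ ⌈t + n⌉₊ := by exact_mod_cast hk
      have hj' : (⌈t + n⌉₊ : ℝ) < j := by exact_mod_cast hj
      have h3 := hAG hjA (j - t) (by linarith)
      rw [h.add, show (j : ℝ) - t + j * (-1) = -t by ring] at h3
      refine h3.trans (le_trans ?_ (est t (by linarith)))
      apply mul_le_mul_of_nonneg_left _ hn0
      have : ε * ⌈t + n⌉₊ ≤ ε * (2 * t) := mul_le_mul_of_nonneg_left (by linarith) hε0.le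
      linarith
  exact fun h0 => hA0 (nonpos_iff_eq_zero.1 (hle.trans h0.le))

/-- `ω` has linear growth forward. -/
def F (θ : ℝ → Ω → Ω) (f : Ω → ℝ) : Set Ω := ⋃ n : ℕ, G θ f n n

lemma mem_F {f : Ω → ℝ} {ω : Ω} {M : ℝ} (hM : ∀ᶠ t : ℝ in atTop, f (θ t ω) ≤ M * t) :
    ω ∈ F θ f := by
  obtain ⟨T, hT⟩ := eventually_atTop.1 hM
  obtain ⟨n, hn⟩ := exists_nat_ge (max M T)
  refine Set.mem_iUnion.2 ⟨n, fun t ht => ?_⟩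
  have h0 : (0 : ℝ) ≤ n := by positivity
  refine (hT t (((le_max_right _ _).trans hn).trans ht)).trans ?_
  exact mul_le_mul_of_nonneg_right ((le_max_left _ _).trans hn) (h0.trans ht)

lemma F_inv (h : AuxFlow P θ) {f : Ω → ℝ} (s : ℝ) (ω : Ω) (hω : ω ∈ F θ f) :
    θ s ω ∈ F θ f := by
  obtain ⟨n, hn⟩ := Set.mem_iUnion.1 hω
  apply mem_F (M := 2 * n)
  filter_upwards [eventually_ge_atTop (n - s), eventually_ge_atTop s] with t h1 h2
  rw [h.add]
  refine (hn (t + s) (by linarith)).trans ?_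
  have h0 : (0 : ℝ) ≤ n := by positivity
  nlinarith

lemma Z_inv (h : AuxFlow P θ) {f : Ω → ℝ} (s : ℝ) (ω : Ω) (hω : ω ∈ Z θ f) :
    θ s ω ∈ Z θ f := by
  simp only [Z, Set.mem_iInter, Set.mem_iUnion] at hω ⊢
  intro m
  obtain ⟨n, hn1, hn2⟩ := hω (2 * m + 1)
  obtain ⟨k, hk⟩ := exists_nat_ge (n + |s|)
  have hs1 := le_abs_self s
  have hs2 := neg_abs_le s
  have h0 : (0 : ℝ) ≤ n := by positivity
  have key : ∀ t u : ℝ, (k : ℝ) ≤ t → u ≤ t + |s| → 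
      1 / (((2 * m + 1 : ℕ) : ℝ) + 1) * u ≤ 1 / (m + 1) * t := by
    intro t u ht hu
    have : 1 / (((2 * m + 1 : ℕ) : ℝ) + 1) = 1 / (m + 1) / 2 := by
      push_cast; field_simp; ring
    rw [this]
    have hp : (0 : ℝ) < 1 / (m + 1) := by positivity
    rw [div_mul_eq_mul_div, mul_div_assoc]
    apply mul_le_mul_of_nonneg_left _ hp.le
    linarith
  refine ⟨k, fun t ht => ?_, fun t ht => ?_⟩
  · rw [h.add]
    exact (hn1 (t + s) (by linarith)).trans (key t _ ht (by linarith))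
  · have h3 := hn2 (t - s) (by linarith)
    simp only [neg_sub] at h3
    simp only [h.add]
    rw [show -t + s = s - t by ring]
    exact h3.trans (key t _ ht (by linarith))

lemma tendsto_of_G {f : Ω → ℝ} (hf0 : ∀ ω, 0 ≤ f ω) {ω : Ω}
    (hω : ∀ m : ℕ, ∃ n : ℕ, ω ∈ G θ f (1 / (m + 1)) n) :
    Tendsto (fun t : ℝ => f (θ t ω) / |t|) atTop (nhds 0) := by
  rw [Metric.tendsto_nhds]
  intro ε hε
  obtain ⟨m, hm⟩ := exists_nat_one_div_lt hε
  obtain ⟨n, hn⟩ := hω m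
  filter_upwards [eventually_ge_atTop (n : ℝ), eventually_gt_atTop 0] with t ht ht0
  rw [Real.dist_eq, sub_zero, abs_of_pos ht0, abs_of_nonneg (div_nonneg (hf0 _) ht0.le)]
  refine lt_of_le_of_lt ?_ hm
  rw [div_le_iff₀ ht0]
  exact hn t ht

lemma freq_of_not_F {f : Ω → ℝ} {ω : Ω} (hω : ω ∉ F θ f) (M : ℝ) :
    ∃ᶠ t : ℝ in atTop, M < f (θ t ω) / |t| := by
  by_contra hc
  rw [not_frequently] at hc
  apply hω
  apply mem_F (M := M)
  filter_upwards [hc, eventually_gt_atTop 0] with t ht ht0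
  rw [not_lt, abs_of_pos ht0, div_le_iff₀ ht0] at ht
  exact ht

lemma dichotomy [IsProbabilityMeasure P] (h : AuxFlow P θ) {f : Ω → ℝ} (hf : Measurable f) :
    P (Z θ f)ᶜ = 0 ∨ (P (F θ f) = 0 ∧ P (F (fun t => θ (-t)) f) = 0) := by
  rcases h.zero_one (h.Z_null hf) h.Z_inv with h0 | h0
  · right
    constructor
    · refine measure_iUnion_null fun n => ?_
      by_contra hc
      exact h.main hf n hc h0
    · refine measure_iUnion_null fun n => ?_
      by_contra hc
      refine h.reverse.main hf n hc ?_
      rwa [Z_reverse]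
  · exact Or.inl h0

end AuxFlow

theorem stmt_1 {Ω : Type*} [MeasurableSpace Ω] (P : Measure Ω) [IsProbabilityMeasure P]
    (θ : ℝ → Ω → Ω)
    (hθ_meas : Measurable fun p : ℝ × Ω => θ p.1 p.2)
    (hθ0 : θ 0 = id)
    (hθ_flow : ∀ s t : ℝ, θ t ∘ θ s = θ (t + s))
    (hθ_pres : ∀ t : ℝ, MeasurePreserving (θ t) P P)
    (hθ_erg : ∀ S : Set Ω, MeasurableSet S → (∀ t : ℝ, θ t ⁻¹' S = S) → P S = 0 ∨ P S = 1)
    (X : Ω → ℝ) (hX_meas : Measurable X) (hX_pos : ∀ ω, 0 < X ω) :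
    (∃ S : Set Ω, MeasurableSet S ∧ P Sᶜ = 0 ∧ (∀ t : ℝ, ∀ ω ∈ S, θ t ω ∈ S) ∧
      ∀ ω ∈ S, Tendsto (fun t : ℝ => max (Real.log (X (θ t ω))) 0 / |t|) atTop (nhds 0) ∧
        Tendsto (fun t : ℝ => max (Real.log (X (θ t ω))) 0 / |t|) atBot (nhds 0)) ∨
    (∃ S : Set Ω, MeasurableSet S ∧ P Sᶜ = 0 ∧ (∀ t : ℝ, ∀ ω ∈ S, θ t ω ∈ S) ∧
      ∀ ω ∈ S, (∀ M : ℝ, ∃ᶠ t : ℝ in atTop, M < max (Real.log (X (θ t ω))) 0 / |t|) ∧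
        (∀ M : ℝ, ∃ᶠ t : ℝ in atBot, M < max (Real.log (X (θ t ω))) 0 / |t|)) := by
  have h : AuxFlow P θ := ⟨hθ_meas, hθ0, hθ_flow, hθ_pres, hθ_erg⟩
  let f : Ω → ℝ := fun ω => max (Real.log (X ω)) 0
  have hf : Measurable f := hX_meas.log.max measurable_const
  have hf0 : ∀ ω, 0 ≤ f ω := fun ω => le_max_right _ _
  rcases h.dichotomy hf with h0 | ⟨h1, h2⟩
  · left
    obtain ⟨S, hS, hS0, hSi, hSN⟩ := h.hull h0 (fun t ω hω hc => hω (by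
      simpa [h.neg_cancel] using h.Z_inv (-t) _ hc))
    refine ⟨S, hS, hS0, hSi, fun ω hω => ?_⟩
    have hz : ω ∈ AuxFlow.Z θ f := not_not.1 (hSN ω hω)
    simp only [AuxFlow.Z, Set.mem_iInter, Set.mem_iUnion] at hz
    refine ⟨AuxFlow.tendsto_of_G hf0 fun m => (hz m).imp fun n hn => hn.1, ?_⟩
    have h3 := (AuxFlow.tendsto_of_G (θ := fun t => θ (-t)) hf0
      fun m => (hz m).imp fun n hn => hn.2).comp tendsto_neg_atBot_atTop
    simpa [Function.comp_def] using h3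
  · right
    obtain ⟨S, hS, hS0, hSi, hSN⟩ := h.hull (measure_union_null h1 h2) (fun t ω hω => hω.imp
      (h.F_inv t ω) (fun h' => by simpa using h.reverse.F_inv (-t) ω h'))
    refine ⟨S, hS, hS0, hSi, fun ω hω => ?_⟩
    have hz := hSN ω hω
    rw [Set.mem_union, not_or] at hz
    refine ⟨AuxFlow.freq_of_not_F hz.1, fun M => ?_⟩
    have h3 := AuxFlow.freq_of_not_F hz.2 M
    have h4 := tendsto_neg_atTop_atBot.frequently
      (p := fun t : ℝ => M < f (θ t ω) / |t|) (by simpa using h3)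
    exact h4
end

section
/- Let H be a Hilbert space with a direct sum decomposition H = E^s ⊕ E^u with bounded projections Π^s, Π^u, and let U^s(t) (t ≥ 0), U^u(t) (t ∈ ℝ) be operator families satisfying ‖U^s(t)Π^s‖ ≤ K e^{β t} for t ≥ 0 and ‖U^u(t)Π^u‖ ≤ K e^{α t} for t ≤ 0, with α > β and K ≥ 1. Let F : ℝ × H → H be measurable in the first variable and globally Lipschitz in the second with constant L satisfying K L (1/(α−γ) + 1/(γ−β)) ≤ 1/2, where γ = (α+β)/2. For ξ ∈ E^u define the Lyapunov–Perron operator on the space C_γ^− = {u : (−∞, 0] → H continuous, sup_{t≤0} e^{-γ t}‖u(t)‖ < ∞} by 𝒥(u, ξ)(t) = U^u(t)ξ + ∫₀^t U^u(t−τ)Π^u F(τ, u(τ)) dτ + ∫_{−∞}^t U^s(t−τ)Π^s F(τ, u(τ)) dτ. Then 𝒥(·, ξ) maps C_γ^− into itself, is a contraction with constant 1/2 in the norm |u|_γ^− = sup_{t≤0} e^{-γ t}‖u(t)‖, and satisfies |𝒥(u, ξ) − 𝒥(u, ξ̄)|_γ^− ≤ K‖ξ − ξ̄‖. Consequently, for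 each ξ ∈ E^u there is a unique fixed point u(·, ξ) ∈ C_γ^−, and ξ ↦ u(·, ξ) is Lipschitz with constant 2K. -/
open MeasureTheory

/-- Weighted norm on functions on `(-∞, 0]`: `|u|_γ^- = sup_{t ≤ 0} e^{-γ t} ‖u t‖`. -/
noncomputable def lpNormM {H : Type*} [NormedAddCommGroup H] (γ : ℝ) (u : ℝ → H) : ℝ :=
  sSup ((fun t => Real.exp (-γ * t) * ‖u t‖) '' Set.Iic 0)

/-- Membership in the space `C_γ^-`. -/
def MemCM {H : Type*} [NormedAddCommGroup H] (γ : ℝ) (u : ℝ → H) : Prop :=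
  ContinuousOn u (Set.Iic 0) ∧
    BddAbove ((fun t => Real.exp (-γ * t) * ‖u t‖) '' Set.Iic 0)

/-- The Lyapunov–Perron operator for the pseudo-unstable manifold. -/
noncomputable def lpJ {H : Type*} [NormedAddCommGroup H] [NormedSpace ℝ H] [CompleteSpace H]
    (Uu Us : ℝ → H →L[ℝ] H) (Pu Ps : H →L[ℝ] H) (F : ℝ → H → H)
    (ξ : H) (u : ℝ → H) (t : ℝ) : H :=
  Uu t ξ + (∫ τ in (0:ℝ)..t, Uu (t - τ) (Pu (F τ (u τ))))
    + ∫ τ in Set.Iic t, Us (t - τ) (Ps (F τ (u τ)))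

section LPHelpers

open Set Filter Topology

theorem lpaux_joint {H : Type*} [NormedAddCommGroup H] [NormedSpace ℝ H]
    (A : ℝ → H →L[ℝ] H) (hA : ∀ x, Continuous fun t => A t x) (C : ℝ → ℝ) (hC : Continuous C)
    (hbd : ∀ t, ‖A t‖ ≤ C t) : Continuous fun p : ℝ × H => A p.1 p.2 := by
  rw [continuous_iff_continuousAt]
  rintro ⟨s0, x0⟩
  have h1 : Tendsto (fun p : ℝ × H => A p.1 (p.2 - x0)) (𝓝 (s0, x0)) (𝓝 0) := by
    have h2 : Tendsto (fun p : ℝ × H => C p.1 * ‖p.2 - x0‖) (𝓝 (s0, x0)) (𝓝 0) := by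
      have h3 : Continuous (fun p : ℝ × H => C p.1 * ‖p.2 - x0‖) := by fun_prop
      have h4 := h3.tendsto (s0, x0)
      simpa using h4
    refine squeeze_zero_norm (fun p => ?_) h2
    exact ((A p.1).le_opNorm _).trans (mul_le_mul_of_nonneg_right (hbd _) (norm_nonneg _))
  have h5 : Tendsto (fun p : ℝ × H => A p.1 x0) (𝓝 (s0, x0)) (𝓝 (A s0 x0)) :=
    ((hA x0).comp continuous_fst).tendsto (s0, x0)
  have h6 := h1.add h5
  simp only [map_sub, sub_add_cancel, zero_add] at h6
  exact h6

theorem lpaux_S {H : Type*} [NormedAddCommGroup H] [NormedSpace ℝ H]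
    (A : ℝ → H →L[ℝ] H) (hA : Continuous fun p : ℝ × H => A p.1 p.2)
    (K β γ M : ℝ) (hK : 0 ≤ K) (hβγ : β < γ)
    (hbd : ∀ t, 0 ≤ t → ‖A t‖ ≤ K * Real.exp (β * t))
    (G : ℝ → H) (hG : Continuous G) (hGM : ∀ t ≤ 0, ‖G t‖ ≤ M * Real.exp (γ * t))
    (t : ℝ) (ht : t ≤ 0) :
    IntegrableOn (fun τ => A (t - τ) (G τ)) (Iic t) ∧
    ‖∫ τ in Iic t, A (t - τ) (G τ)‖ ≤ K * M * (1 / (γ - β)) * Real.exp (γ * t) := by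
  have hb : ∀ τ ∈ Iic t, ‖A (t - τ) (G τ)‖ ≤
      K * M * Real.exp (β * t) * Real.exp ((γ - β) * τ) := by
    intro τ hτ
    have hτ' : τ ≤ t := hτ
    calc ‖A (t - τ) (G τ)‖ ≤ ‖A (t - τ)‖ * ‖G τ‖ := (A _).le_opNorm _
      _ ≤ (K * Real.exp (β * (t - τ))) * (M * Real.exp (γ * τ)) :=
        mul_le_mul (hbd _ (by linarith)) (hGM _ (by linarith)) (norm_nonneg _) (by positivity)
      _ = K * M * (Real.exp (β * (t - τ)) * Real.exp (γ * τ)) := by ring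
      _ = K * M * (Real.exp (β * t) * Real.exp ((γ - β) * τ)) := by
        rw [← Real.exp_add, ← Real.exp_add]; ring_nf
      _ = _ := by ring
  have hintg : IntegrableOn (fun τ => K * M * Real.exp (β * t) * Real.exp ((γ - β) * τ)) (Iic t) :=
    (integrableOn_exp_mul_Iic (by linarith) t).const_mul _
  have hc : Continuous (fun τ => A (t - τ) (G τ)) :=
    hA.comp ((continuous_const.sub continuous_id).prodMk hG)
  have hae : ∀ᵐ τ ∂(volume.restrict (Iic t)), ‖A (t - τ) (G τ)‖ ≤
      K * M * Real.exp (β * t) * Real.exp ((γ - β) * τ) :=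
    (ae_restrict_iff' measurableSet_Iic).2 (Eventually.of_forall hb)
  refine ⟨Integrable.mono' hintg (hc.continuousOn.aestronglyMeasurable measurableSet_Iic) hae, ?_⟩
  refine (norm_integral_le_of_norm_le hintg hae).trans (le_of_eq ?_)
  rw [integral_const_mul, integral_exp_mul_Iic (by linarith)]
  have : Real.exp (γ * t) = Real.exp (β * t) * Real.exp ((γ - β) * t) := by
    rw [← Real.exp_add]; ring_nf
  rw [this]; ring

theorem lpaux_Scont {H : Type*} [NormedAddCommGroup H] [NormedSpace ℝ H]
    (A : ℝ → H →L[ℝ] H) (hA : Continuous fun p : ℝ × H => A p.1 p.2)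
    (K β γ M : ℝ) (hK : 0 ≤ K) (hβγ : β < γ)
    (hbd : ∀ t, 0 ≤ t → ‖A t‖ ≤ K * Real.exp (β * t))
    (G : ℝ → H) (hG : Continuous G) (hGM : ∀ t ≤ 0, ‖G t‖ ≤ M * Real.exp (γ * t)) :
    ContinuousOn (fun t => ∫ τ in Iic t, A (t - τ) (G τ)) (Iic 0) := by
  have h1 : ∀ t, ∫ τ in Iic t, A (t - τ) (G τ) =
      Real.exp (γ * t) • ∫ s in Ici (0:ℝ), Real.exp (-γ * t) • A s (G (t - s)) := by
    intro t
    have h := (Measure.measurePreserving_sub_left (volume : Measure ℝ) t).setIntegral_preimage_emb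
      (Homeomorph.subLeft t).measurableEmbedding (fun τ => A (t - τ) (G τ)) (Iic t)
    have hp : (fun x => t - x) ⁻¹' Iic t = Ici 0 := by ext x; simp
    rw [hp] at h
    rw [← h, integral_smul, smul_smul, ← Real.exp_add]
    simp
  simp_rw [h1]
  refine ContinuousOn.smul (by fun_prop) ?_
  refine continuousOn_of_dominated (bound := fun s => K * M * Real.exp ((β - γ) * s)) ?_ ?_ ?_ ?_
  · intro t _
    have hc : Continuous (fun s => Real.exp (-γ * t) • A s (G (t - s))) := by
      have := hA.comp (continuous_id.prodMk (hG.comp (continuous_const.sub continuous_id :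
        Continuous fun s : ℝ => t - s)))
      exact this.const_smul (Real.exp (-γ * t))
    exact hc.continuousOn.aestronglyMeasurable measurableSet_Ici
  · intro t ht
    have ht' : t ≤ 0 := ht
    refine (ae_restrict_iff' measurableSet_Ici).2 (Eventually.of_forall fun s hs => ?_)
    have hs' : 0 ≤ s := hs
    rw [norm_smul, Real.norm_of_nonneg (Real.exp_pos _).le]
    calc Real.exp (-γ * t) * ‖A s (G (t - s))‖ ≤ Real.exp (-γ * t) * (‖A s‖ * ‖G (t - s)‖) := by
          gcongr; exact (A _).le_opNorm _
      _ ≤ Real.exp (-γ * t) * ((K * Real.exp (β * s)) * (M * Real.exp (γ * (t - s)))) := by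
        refine mul_le_mul_of_nonneg_left ?_ (Real.exp_pos _).le
        exact mul_le_mul (hbd _ hs') (hGM _ (by linarith)) (norm_nonneg _) (by positivity)
      _ = K * M * (Real.exp (-γ * t) * Real.exp (β * s) * Real.exp (γ * (t - s))) := by ring
      _ = _ := by
        rw [← Real.exp_add, ← Real.exp_add]; ring_nf
  · have : IntegrableOn (fun s => Real.exp ((β - γ) * s)) (Ici 0) := by
      rw [integrableOn_Ici_iff_integrableOn_Ioi]
      exact integrableOn_exp_mul_Ioi (by linarith) 0
    exact this.const_mul _
  · refine Eventually.of_forall fun s => ?_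
    have : Continuous (fun t => Real.exp (-γ * t) • A s (G (t - s))) := by
      have := (A s).continuous.comp (hG.comp (continuous_id.sub continuous_const :
        Continuous fun t : ℝ => t - s))
      exact Continuous.smul (by fun_prop) this
    exact this.continuousOn

theorem lpaux_U {H : Type*} [NormedAddCommGroup H] [NormedSpace ℝ H]
    (B : ℝ → H →L[ℝ] H)
    (K α γ M : ℝ) (hK : 0 ≤ K) (hM : 0 ≤ M) (hγα : γ < α)
    (hbd : ∀ t, t ≤ 0 → ‖B t‖ ≤ K * Real.exp (α * t))
    (G : ℝ → H) (hGM : ∀ t ≤ 0, ‖G t‖ ≤ M * Real.exp (γ * t))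
    (t : ℝ) (ht : t ≤ 0) :
    ‖∫ τ in (0:ℝ)..t, B (t - τ) (G τ)‖ ≤ K * M * (1 / (α - γ)) * Real.exp (γ * t) := by
  rw [intervalIntegral.integral_symm, norm_neg]
  have hb : ∀ τ ∈ Ioc t 0, ‖B (t - τ) (G τ)‖ ≤
      K * M * Real.exp (α * t) * Real.exp ((γ - α) * τ) := by
    rintro τ ⟨hτ', h0⟩
    calc ‖B (t - τ) (G τ)‖ ≤ ‖B (t - τ)‖ * ‖G τ‖ := (B _).le_opNorm _
      _ ≤ (K * Real.exp (α * (t - τ))) * (M * Real.exp (γ * τ)) :=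
        mul_le_mul (hbd _ (by linarith)) (hGM _ (by linarith)) (norm_nonneg _) (by positivity)
      _ = K * M * (Real.exp (α * (t - τ)) * Real.exp (γ * τ)) := by ring
      _ = K * M * (Real.exp (α * t) * Real.exp ((γ - α) * τ)) := by
        rw [← Real.exp_add, ← Real.exp_add]; ring_nf
      _ = _ := by ring
  have hb' : ∀ᵐ τ, τ ∈ Ioc t 0 → ‖B (t - τ) (G τ)‖ ≤
      K * M * Real.exp (α * t) * Real.exp ((γ - α) * τ) := Eventually.of_forall hb
  refine (intervalIntegral.norm_integral_le_of_norm_le ht hb'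
    (Continuous.intervalIntegrable (by fun_prop) _ _)).trans ?_
  rw [intervalIntegral.integral_const_mul]
  have hne : γ - α ≠ 0 := by linarith
  rw [intervalIntegral.integral_comp_mul_left (fun x => Real.exp x) hne, integral_exp]
  have h1 : Real.exp (γ * t) = Real.exp (α * t) * Real.exp ((γ - α) * t) := by
    rw [← Real.exp_add]; ring_nf
  have h2 : (γ - α)⁻¹ = - (1 / (α - γ)) := by
    rw [← neg_sub α γ, inv_neg, one_div]
  have h3 : 0 < 1 / (α - γ) := by apply one_div_pos.2; linarith
  rw [h1, h2, mul_zero, Real.exp_zero, smul_eq_mul]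
  have h4 : 0 ≤ K * M * Real.exp (α * t) * (1 / (α - γ)) := by positivity
  nlinarith

end LPHelpers

theorem stmt_11 {H : Type*} [NormedAddCommGroup H] [NormedSpace ℝ H] [CompleteSpace H]
    (Ps Pu : H →L[ℝ] H)
    (hproj : Ps + Pu = ContinuousLinearMap.id ℝ H)
    (hPs : Ps.comp Ps = Ps) (hPu : Pu.comp Pu = Pu)
    (Us Uu : ℝ → H →L[ℝ] H)
    (hUs_cont : ∀ x : H, Continuous fun t => Us t x)
    (hUu_cont : ∀ x : H, Continuous fun t => Uu t x)
    (α β γ K L : ℝ) (hβα : β < α) (hγ : γ = (α + β) / 2) (hK : 1 ≤ K) (hL : 0 ≤ L)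
    (hUs_bd : ∀ t : ℝ, 0 ≤ t → ‖(Us t).comp Ps‖ ≤ K * Real.exp (β * t))
    (hUu_bd : ∀ t : ℝ, t ≤ 0 → ‖(Uu t).comp Pu‖ ≤ K * Real.exp (α * t))
    (hsmall : K * L * (1 / (α - γ) + 1 / (γ - β)) ≤ 1 / 2)
    (F : ℝ → H → H)
    (hF_cont : Continuous fun p : ℝ × H => F p.1 p.2)
    (hF0 : ∀ t, F t 0 = 0)
    (hF_lip : ∀ t : ℝ, ∀ x y : H, ‖F t x - F t y‖ ≤ L * ‖x - y‖) :
    -- (1) 𝒥(·, ξ) maps C_γ^- into itself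
    (∀ ξ : H, Pu ξ = ξ → ∀ u, MemCM γ u → MemCM γ (lpJ Uu Us Pu Ps F ξ u)) ∧
    -- (2) contraction with constant 1/2
    (∀ ξ : H, Pu ξ = ξ → ∀ u v, MemCM γ u → MemCM γ v →
      lpNormM γ (fun t => lpJ Uu Us Pu Ps F ξ u t - lpJ Uu Us Pu Ps F ξ v t) ≤
        (1 / 2) * lpNormM γ (fun t => u t - v t)) ∧
    -- (3) Lipschitz dependence on ξ
    (∀ ξ ξ' : H, Pu ξ = ξ → Pu ξ' = ξ' → ∀ u, MemCM γ u →
      lpNormM γ (fun t => lpJ Uu Us Pu Ps F ξ u t - lpJ Uu Us Pu Ps F ξ' u t) ≤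
        K * ‖ξ - ξ'‖) ∧
    -- (4) existence and uniqueness of the fixed point
    (∀ ξ : H, Pu ξ = ξ → ∃ u, MemCM γ u ∧ (∀ t : ℝ, t ≤ 0 → lpJ Uu Us Pu Ps F ξ u t = u t) ∧
      ∀ v, MemCM γ v → (∀ t : ℝ, t ≤ 0 → lpJ Uu Us Pu Ps F ξ v t = v t) →
        ∀ t : ℝ, t ≤ 0 → v t = u t) ∧
    -- (5) the fixed point is 2K-Lipschitz in ξ
    (∀ ξ ξ' : H, Pu ξ = ξ → Pu ξ' = ξ' → ∀ u u', MemCM γ u → MemCM γ u' →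
      (∀ t : ℝ, t ≤ 0 → lpJ Uu Us Pu Ps F ξ u t = u t) →
      (∀ t : ℝ, t ≤ 0 → lpJ Uu Us Pu Ps F ξ' u' t = u' t) →
      lpNormM γ (fun t => u t - u' t) ≤ 2 * K * ‖ξ - ξ'‖) := by
  have hK0 : 0 ≤ K := by linarith
  have hβγ : β < γ := by linarith
  have hγα : γ < α := by linarith
  set A : ℝ → H →L[ℝ] H := fun s => (Us (max s 0)).comp Ps with hAdef
  set B : ℝ → H →L[ℝ] H := fun s => (Uu (min s 0)).comp Pu with hBdef
  have hAj : Continuous fun p : ℝ × H => A p.1 p.2 := by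
    refine lpaux_joint A (fun x => ?_) (fun s => K * Real.exp (β * max s 0)) (by fun_prop)
      (fun t => hUs_bd _ (le_max_right _ _))
    exact (hUs_cont (Ps x)).comp (by fun_prop : Continuous fun s : ℝ => max s 0)
  have hBj : Continuous fun p : ℝ × H => B p.1 p.2 := by
    refine lpaux_joint B (fun x => ?_) (fun s => K * Real.exp (α * min s 0)) (by fun_prop)
      (fun t => hUu_bd _ (min_le_right _ _))
    exact (hUu_cont (Pu x)).comp (by fun_prop : Continuous fun s : ℝ => min s 0)
  have hAb : ∀ t, 0 ≤ t → ‖A t‖ ≤ K * Real.exp (β * t) := by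
    intro t ht
    simp only [hAdef, max_eq_left ht]
    exact hUs_bd t ht
  have hBb : ∀ t, t ≤ 0 → ‖B t‖ ≤ K * Real.exp (α * t) := by
    intro t ht
    simp only [hBdef, min_eq_left ht]
    exact hUu_bd t ht
  -- the forcing term, extended to all times
  set g : (ℝ → H) → ℝ → H := fun u τ => F τ (u (min τ 0)) with hgdef
  have hgc : ∀ u, MemCM γ u → Continuous (g u) := by
    intro u hu
    have h1 : Continuous fun τ : ℝ => u (min τ 0) :=
      hu.1.comp_continuous (by fun_prop) (fun τ => min_le_right τ 0)
    exact hF_cont.comp (continuous_id.prodMk h1)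
  have hbound : ∀ u : ℝ → H, BddAbove ((fun t => Real.exp (-γ * t) * ‖u t‖) '' Set.Iic 0) →
      ∀ t ≤ 0, ‖u t‖ ≤ lpNormM γ u * Real.exp (γ * t) := by
    intro u hu t ht
    have h1 : Real.exp (-γ * t) * ‖u t‖ ≤ lpNormM γ u := le_csSup hu ⟨t, ht, rfl⟩
    have h2 : Real.exp (γ * t) * Real.exp (-γ * t) = 1 := by
      rw [← Real.exp_add]; simp
    calc ‖u t‖ = (Real.exp (-γ * t) * ‖u t‖) * Real.exp (γ * t) := by
          linear_combination (-‖u t‖) * h2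
      _ ≤ _ := mul_le_mul_of_nonneg_right h1 (Real.exp_pos _).le
  have hconv : ∀ (x C t : ℝ), x ≤ C * Real.exp (γ * t) → Real.exp (-γ * t) * x ≤ C := by
    intro x C t h
    have h2 : Real.exp (γ * t) * Real.exp (-γ * t) = 1 := by
      rw [← Real.exp_add]; simp
    calc Real.exp (-γ * t) * x ≤ Real.exp (-γ * t) * (C * Real.exp (γ * t)) :=
          mul_le_mul_of_nonneg_left h (Real.exp_pos _).le
      _ = C := by linear_combination C * h2
  have hnle : ∀ (u : ℝ → H) (C : ℝ), (∀ t ≤ 0, ‖u t‖ ≤ C * Real.exp (γ * t)) →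
      BddAbove ((fun t => Real.exp (-γ * t) * ‖u t‖) '' Set.Iic 0) ∧ lpNormM γ u ≤ C := by
    intro u C h
    have h1 : ∀ x ∈ (fun t => Real.exp (-γ * t) * ‖u t‖) '' Set.Iic 0, x ≤ C := by
      rintro _ ⟨t, ht, rfl⟩
      exact hconv _ _ _ (h t ht)
    exact ⟨⟨C, h1⟩, csSup_le ⟨_, 0, Set.mem_Iic.2 le_rfl, rfl⟩ h1⟩
  have hnn : ∀ u : ℝ → H, 0 ≤ lpNormM γ u := by
    intro u
    apply Real.sSup_nonneg
    rintro _ ⟨t, _, rfl⟩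
    positivity
  have hgM : ∀ (u v : ℝ → H) (M : ℝ), (∀ t ≤ 0, ‖u t - v t‖ ≤ M * Real.exp (γ * t)) →
      ∀ t ≤ 0, ‖g u t - g v t‖ ≤ L * M * Real.exp (γ * t) := by
    intro u v M h t ht
    simp only [hgdef, min_eq_left ht]
    calc _ ≤ L * ‖u t - v t‖ := hF_lip _ _ _
      _ ≤ L * (M * Real.exp (γ * t)) := mul_le_mul_of_nonneg_left (h t ht) hL
      _ = _ := by ring
  have hgM0 : ∀ u, MemCM γ u → ∀ t ≤ 0, ‖g u t‖ ≤ L * lpNormM γ u * Real.exp (γ * t) := by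
    intro u hu t ht
    have := hgM u (fun _ => 0) (lpNormM γ u) (fun t ht => by simpa using hbound u hu.2 t ht) t ht
    simpa [hgdef, hF0] using this
  have hJ : ∀ ξ u t, t ≤ 0 → lpJ Uu Us Pu Ps F ξ u t =
      Uu t ξ + (∫ τ in (0:ℝ)..t, B (t - τ) (g u τ)) + ∫ τ in Set.Iic t, A (t - τ) (g u τ) := by
    intro ξ u t ht
    unfold lpJ
    congr 1
    · congr 1
      apply intervalIntegral.integral_congr
      intro τ hτ
      rw [Set.uIcc_of_ge ht] at hτ
      simp only [hBdef, hgdef, min_eq_left hτ.2, min_eq_left (sub_nonpos.2 hτ.1),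
        ContinuousLinearMap.comp_apply]
    · apply setIntegral_congr_fun measurableSet_Iic
      intro τ hτ
      have hτ' : τ ≤ t := hτ
      simp only [hAdef, hgdef, min_eq_left (hτ'.trans ht), max_eq_left (sub_nonneg.2 hτ'),
        ContinuousLinearMap.comp_apply]
  -- pointwise contraction estimate
  have key : ∀ (ξ : H) (u v : ℝ → H), MemCM γ u → MemCM γ v → ∀ M, 0 ≤ M →
      (∀ t ≤ 0, ‖u t - v t‖ ≤ M * Real.exp (γ * t)) → ∀ t ≤ 0,
      ‖lpJ Uu Us Pu Ps F ξ u t - lpJ Uu Us Pu Ps F ξ v t‖ ≤ (1 / 2 * M) * Real.exp (γ * t) := by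
    intro ξ u v hu hv M hM h t ht
    have hd := hgM u v M h
    have hLM : 0 ≤ L * M := mul_nonneg hL hM
    have e1 := lpaux_U B K α γ (L * M) hK0 hLM hγα hBb (fun τ => g u τ - g v τ) hd t ht
    have e2 := (lpaux_S A hAj K β γ (L * M) hK0 hβγ hAb (fun τ => g u τ - g v τ)
      ((hgc u hu).sub (hgc v hv)) hd t ht).2
    have i1 := (lpaux_S A hAj K β γ _ hK0 hβγ hAb (g u) (hgc u hu) (hgM0 u hu) t ht).1
    have i2 := (lpaux_S A hAj K β γ _ hK0 hβγ hAb (g v) (hgc v hv) (hgM0 v hv) t ht).1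
    have c1 : ∀ w, MemCM γ w → Continuous fun τ => B (t - τ) (g w τ) := fun w hw =>
      hBj.comp ((continuous_const.sub continuous_id).prodMk (hgc w hw))
    simp only [map_sub] at e1 e2
    rw [intervalIntegral.integral_sub ((c1 u hu).intervalIntegrable _ _)
      ((c1 v hv).intervalIntegrable _ _)] at e1
    rw [integral_sub i1 i2] at e2
    rw [hJ ξ u t ht, hJ ξ v t ht]
    have h3 := norm_add_le
      ((∫ τ in (0:ℝ)..t, B (t - τ) (g u τ)) - ∫ τ in (0:ℝ)..t, B (t - τ) (g v τ))
      ((∫ τ in Set.Iic t, A (t - τ) (g u τ)) - ∫ τ in Set.Iic t, A (t - τ) (g v τ))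
    have h4 := mul_le_mul_of_nonneg_right hsmall (mul_nonneg hM (Real.exp_pos (γ * t)).le)
    refine le_trans (le_of_eq ?_) (h3.trans ?_)
    · congr 1; abel
    · refine (add_le_add e1 e2).trans ?_
      linarith
  have key2 : ∀ x t, Pu x = x → t ≤ 0 → ‖Uu t x‖ ≤ (K * ‖x‖) * Real.exp (γ * t) := by
    intro x t hx ht
    have h1 : Uu t x = ((Uu t).comp Pu) x := by simp [hx]
    have h2 : Real.exp (α * t) ≤ Real.exp (γ * t) := by
      apply Real.exp_le_exp.2; nlinarith
    rw [h1]
    calc _ ≤ ‖(Uu t).comp Pu‖ * ‖x‖ := ContinuousLinearMap.le_opNorm _ _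
      _ ≤ (K * Real.exp (α * t)) * ‖x‖ :=
        mul_le_mul_of_nonneg_right (hUu_bd t ht) (norm_nonneg _)
      _ ≤ (K * Real.exp (γ * t)) * ‖x‖ := by gcongr
      _ = _ := by ring
  have key3 : ∀ ξ ξ' : H, Pu ξ = ξ → Pu ξ' = ξ' → ∀ u, ∀ t ≤ 0,
      ‖lpJ Uu Us Pu Ps F ξ u t - lpJ Uu Us Pu Ps F ξ' u t‖ ≤
        (K * ‖ξ - ξ'‖) * Real.exp (γ * t) := by
    intro ξ ξ' hξ hξ' u t ht
    have h1 : lpJ Uu Us Pu Ps F ξ u t - lpJ Uu Us Pu Ps F ξ' u t = Uu t (ξ - ξ') := by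
      unfold lpJ; rw [map_sub]; abel
    rw [h1]
    exact key2 _ _ (by rw [map_sub, hξ, hξ']) ht
  have hsub : ∀ u v : ℝ → H, MemCM γ u → MemCM γ v → ∀ t ≤ 0,
      ‖u t - v t‖ ≤ lpNormM γ (fun t => u t - v t) * Real.exp (γ * t) := by
    intro u v hu hv
    refine hbound (fun t => u t - v t) (hnle _ (lpNormM γ u + lpNormM γ v) ?_).1
    intro t ht
    have h1 := hbound u hu.2 t ht
    have h2 := hbound v hv.2 t ht
    have h3 := norm_sub_le (u t) (v t)
    linarith
  have h0mem : MemCM γ (fun _ : ℝ => (0 : H)) :=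
    ⟨continuousOn_const, (hnle _ 0 (by simp)).1⟩
  have P1 : ∀ ξ : H, Pu ξ = ξ → ∀ u, MemCM γ u → MemCM γ (lpJ Uu Us Pu Ps F ξ u) := by
    intro ξ hξ u hu
    constructor
    · have hc : ContinuousOn (fun t => Uu t ξ + (∫ τ in (0:ℝ)..t, B (t - τ) (g u τ)) +
          ∫ τ in Set.Iic t, A (t - τ) (g u τ)) (Set.Iic 0) := by
        refine ContinuousOn.add (Continuous.continuousOn ((hUu_cont ξ).add ?_))
          (lpaux_Scont A hAj K β γ _ hK0 hβγ hAb (g u) (hgc u hu) (hgM0 u hu))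
        refine intervalIntegral.continuous_parametric_intervalIntegral_of_continuous
          (f := fun t τ => B (t - τ) (g u τ)) ?_ continuous_id
        exact hBj.comp ((continuous_fst.sub continuous_snd).prodMk
          ((hgc u hu).comp continuous_snd))
      exact hc.congr fun t ht => hJ ξ u t ht
    · refine (hnle _ (1 / 2 * lpNormM γ u + K * ‖ξ‖) ?_).1
      intro t ht
      have h1 := key ξ u (fun _ => 0) hu h0mem (lpNormM γ u) (hnn u)
        (fun t ht => by simpa using hbound u hu.2 t ht) t ht
      have h2 : lpJ Uu Us Pu Ps F ξ (fun _ => 0) t = Uu t ξ := by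
        unfold lpJ; simp [hF0]
      rw [h2] at h1
      have h3 := key2 ξ t hξ ht
      have h4 := norm_le_norm_sub_add (lpJ Uu Us Pu Ps F ξ u t) (Uu t ξ)
      linarith
  have P5 : ∀ ξ ξ' : H, Pu ξ = ξ → Pu ξ' = ξ' → ∀ u u', MemCM γ u → MemCM γ u' →
      (∀ t : ℝ, t ≤ 0 → lpJ Uu Us Pu Ps F ξ u t = u t) →
      (∀ t : ℝ, t ≤ 0 → lpJ Uu Us Pu Ps F ξ' u' t = u' t) →
      lpNormM γ (fun t => u t - u' t) ≤ 2 * K * ‖ξ - ξ'‖ := by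
    intro ξ ξ' hξ hξ' u u' hu hu' hf hf'
    have h := (hnle (fun t => u t - u' t)
      (1 / 2 * lpNormM γ (fun t => u t - u' t) + K * ‖ξ - ξ'‖) ?_).2
    · linarith
    · intro t ht
      have h1 := key ξ u u' hu hu' _ (hnn _) (hsub u u' hu hu') t ht
      have h2 := key3 ξ ξ' hξ hξ' u' t ht
      rw [hf t ht] at h1
      rw [hf' t ht] at h2
      have h3 := norm_sub_le_norm_sub_add_norm_sub (u t) (lpJ Uu Us Pu Ps F ξ u' t) (u' t)
      show ‖u t - u' t‖ ≤ _
      linarith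
  refine ⟨P1, ?_, ?_, ?_, P5⟩
  · intro ξ hξ u v hu hv
    exact (hnle _ _ (key ξ u v hu hv _ (hnn _) (hsub u v hu hv))).2
  · intro ξ ξ' hξ hξ' u hu
    exact (hnle _ _ (key3 ξ ξ' hξ hξ' u)).2
  · intro ξ hξ
    -- weighted functions coming from bounded continuous functions
    set U : BoundedContinuousFunction ℝ H → ℝ → H := fun w t => Real.exp (γ * t) • w t with hU
    have hUb : ∀ w w' : BoundedContinuousFunction ℝ H, ∀ t,
        ‖U w t - U w' t‖ ≤ dist w w' * Real.exp (γ * t) := by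
      intro w w' t
      simp only [hU]
      rw [← smul_sub, norm_smul, Real.norm_of_nonneg (Real.exp_pos _).le, mul_comm, ← dist_eq_norm]
      exact mul_le_mul_of_nonneg_right (BoundedContinuousFunction.dist_coe_le_dist t)
        (Real.exp_pos _).le
    have hUm : ∀ w, MemCM γ (U w) := by
      intro w
      refine ⟨Continuous.continuousOn (Continuous.smul (by fun_prop) w.continuous),
        (hnle _ (dist w 0) fun t _ => ?_).1⟩
      simpa [hU] using hUb w 0 t
    have hJm := fun w => P1 ξ hξ (U w) (hUm w)
    have hcont : ∀ w, Continuous fun t : ℝ =>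
        Real.exp (-γ * min t 0) • lpJ Uu Us Pu Ps F ξ (U w) (min t 0) := fun w =>
      Continuous.smul (by fun_prop)
        ((hJm w).1.comp_continuous (by fun_prop) (fun τ => min_le_right τ 0))
    have hbd : ∀ w (t : ℝ), ‖Real.exp (-γ * min t 0) • lpJ Uu Us Pu Ps F ξ (U w) (min t 0)‖ ≤
        lpNormM γ (lpJ Uu Us Pu Ps F ξ (U w)) := by
      intro w t
      rw [norm_smul, Real.norm_of_nonneg (Real.exp_pos _).le]
      exact hconv _ _ _ (hbound _ (hJm w).2 _ (min_le_right _ _))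
    set Φ : BoundedContinuousFunction ℝ H → BoundedContinuousFunction ℝ H := fun w =>
      BoundedContinuousFunction.ofNormedAddCommGroup _ (hcont w) _ (hbd w) with hΦ
    have hΦapp : ∀ w t, Φ w t =
        Real.exp (-γ * min t 0) • lpJ Uu Us Pu Ps F ξ (U w) (min t 0) := fun w t => rfl
    have hcontr : ContractingWith (1 / 2 : NNReal) Φ := by
      refine ⟨by rw [← NNReal.coe_lt_coe]; norm_num, LipschitzWith.of_dist_le_mul fun w w' => ?_⟩
      rw [BoundedContinuousFunction.dist_le (by positivity)]
      intro t
      rw [hΦapp, hΦapp, dist_eq_norm, ← smul_sub, norm_smul,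
        Real.norm_of_nonneg (Real.exp_pos _).le]
      have := hconv _ _ _ (key ξ (U w) (U w') (hUm w) (hUm w') (dist w w') dist_nonneg
        (fun t _ => hUb w w' t) (min t 0) (min_le_right _ _))
      simpa using this
    have hfix := hcontr.fixedPoint_isFixedPt
    set w := ContractingWith.fixedPoint Φ hcontr with hw
    have hUfix : ∀ t : ℝ, t ≤ 0 → lpJ Uu Us Pu Ps F ξ (U w) t = U w t := by
      intro t ht
      have h1 : Φ w t = w t := by rw [hfix.eq]
      rw [hΦapp, min_eq_left ht] at h1
      show _ = Real.exp (γ * t) • w t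
      rw [← h1, smul_smul, ← Real.exp_add]
      simp
    refine ⟨U w, hUm w, hUfix, fun v hv hvf t ht => ?_⟩
    have h1 := P5 ξ ξ hξ hξ v (U w) hv (hUm w) hvf hUfix
    have h2 := hsub v (U w) hv (hUm w) t ht
    have h3 : lpNormM γ (fun t => v t - U w t) = 0 := le_antisymm (by simpa using h1) (hnn _)
    rw [h3, zero_mul] at h2
    exact sub_eq_zero.1 (norm_le_zero_iff.1 h2)
end
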